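/- arXiv:2508.20290 — 3 statements merged into one kernel-verified Lean document; each statement's English description precedes it below -/
import Mathlib

section
/- Let f : ℝ → ℝ be continuously differentiable on an open set containing x₀, where x₀ lies in the interior of the domain Ω = [a,b]. Then the one-sided derivative at L = 0 of the map L ↦ VC_L(f, x₀) exists and equals |f'(x₀)|; that is, lim_{L→0⁺} VC_L(f, x₀)/L = |f'(x₀)| (noting VC_0(f, x₀) = 0). -/
/-- The value change (VC) of `f : ℝ → ℝ` at `x` over the domain `Ω`,
with window `[x - L/2, x + L/2]`. -/
noncomputable def VC1 (Ω : Set ℝ) (f : ℝ → ℝ) (L : ℝ) (x : ℝ) : ℝ :=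
  sSup {v : ℝ | ∃ y₁ ∈ Ω ∩ Set.Icc (x - L / 2) (x + L / 2),
    ∃ y₂ ∈ Ω ∩ Set.Icc (x - L / 2) (x + L / 2), v = |f y₁ - f y₂|}

/-- If `f` is continuously differentiable on an open set containing `x₀`, and `x₀` lies in
the interior of `Ω = [a,b]`, then `lim_{L→0⁺} VC_L(f,x₀)/L = |f'(x₀)|`. -/
theorem stmt_0 (a b x₀ : ℝ) (hab : a < b) (hx₀ : x₀ ∈ Set.Ioo a b)
    (f : ℝ → ℝ) (U : Set ℝ) (hU : IsOpen U) (hx₀U : x₀ ∈ U)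
    (hf : ContDiffOn ℝ 1 f U) :
    Filter.Tendsto (fun L : ℝ => VC1 (Set.Icc a b) f L x₀ / L)
      (nhdsWithin 0 (Set.Ioi 0)) (nhds |deriv f x₀|) := by
  have hc : ContDiffAt ℝ 1 f x₀ := hf.contDiffAt (hU.mem_nhds hx₀U)
  have hs : HasStrictDerivAt f (deriv f x₀) x₀ := hc.hasStrictDerivAt (by norm_num)
  generalize deriv f x₀ = d at hs ⊢
  rw [Metric.tendsto_nhds]
  intro ε hε
  have ho := (hasStrictFDerivAt_iff_isLittleO.mp hs.hasStrictFDerivAt).def (half_pos hε)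
  rw [Metric.eventually_nhds_iff] at ho
  obtain ⟨δ, hδ, ho⟩ := ho
  have key : ∀ y₁ y₂ : ℝ, |y₁ - x₀| < δ → |y₂ - x₀| < δ →
      |f y₁ - f y₂ - d * (y₁ - y₂)| ≤ ε / 2 * |y₁ - y₂| := by
    intro y₁ y₂ h1 h2
    have h := @ho (y₁, y₂) (by
      rw [Prod.dist_eq, max_lt_iff]
      exact ⟨by simpa [Real.dist_eq] using h1, by simpa [Real.dist_eq] using h2⟩)
    simpa [Real.norm_eq_abs, mul_comm] using h
  obtain ⟨ha, hb⟩ := hx₀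
  have hm : 0 < min δ (min (x₀ - a) (b - x₀)) :=
    lt_min hδ (lt_min (by linarith) (by linarith))
  filter_upwards [Ioo_mem_nhdsGT hm] with L hL
  obtain ⟨hL0, hL⟩ := hL
  rw [lt_min_iff, lt_min_iff] at hL
  obtain ⟨hLδ, hLa, hLb⟩ := hL
  have hub : ∀ v ∈ {v : ℝ | ∃ y₁ ∈ Set.Icc a b ∩ Set.Icc (x₀ - L / 2) (x₀ + L / 2),
      ∃ y₂ ∈ Set.Icc a b ∩ Set.Icc (x₀ - L / 2) (x₀ + L / 2), v = |f y₁ - f y₂|},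
      v ≤ (|d| + ε / 2) * L := by
    rintro v ⟨y₁, ⟨_, h1, h1'⟩, y₂, ⟨_, h2, h2'⟩, rfl⟩
    have hk := key y₁ y₂ (by rw [abs_lt]; constructor <;> linarith)
      (by rw [abs_lt]; constructor <;> linarith)
    have hyL : |y₁ - y₂| ≤ L := by rw [abs_le]; constructor <;> linarith
    have ht := abs_add_le (f y₁ - f y₂ - d * (y₁ - y₂)) (d * (y₁ - y₂))
    rw [sub_add_cancel, abs_mul] at ht
    have hfin : (|d| + ε / 2) * |y₁ - y₂| ≤ (|d| + ε / 2) * L :=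
      mul_le_mul_of_nonneg_left hyL (by positivity)
    linarith
  have hmem : |f (x₀ + L / 2) - f (x₀ - L / 2)| ∈
      {v : ℝ | ∃ y₁ ∈ Set.Icc a b ∩ Set.Icc (x₀ - L / 2) (x₀ + L / 2),
      ∃ y₂ ∈ Set.Icc a b ∩ Set.Icc (x₀ - L / 2) (x₀ + L / 2), v = |f y₁ - f y₂|} := by
    refine ⟨x₀ + L / 2, ⟨⟨?_, ?_⟩, ?_, ?_⟩, x₀ - L / 2, ⟨⟨?_, ?_⟩, ?_, ?_⟩, rfl⟩ <;> linarith
  have hup : VC1 (Set.Icc a b) f L x₀ ≤ (|d| + ε / 2) * L := csSup_le ⟨_, hmem⟩ hub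
  have hlo : |f (x₀ + L / 2) - f (x₀ - L / 2)| ≤ VC1 (Set.Icc a b) f L x₀ :=
    le_csSup ⟨_, hub⟩ hmem
  have hk := key (x₀ + L / 2) (x₀ - L / 2) (by rw [abs_lt]; constructor <;> linarith)
      (by rw [abs_lt]; constructor <;> linarith)
  have he : x₀ + L / 2 - (x₀ - L / 2) = L := by ring
  rw [he, abs_of_pos hL0] at hk
  have ht := abs_sub_abs_le_abs_sub (d * L) (f (x₀ + L / 2) - f (x₀ - L / 2))
  rw [abs_sub_comm (d * L), abs_mul, abs_of_pos hL0] at ht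
  have h1 : VC1 (Set.Icc a b) f L x₀ / L ≤ |d| + ε / 2 := (div_le_iff₀ hL0).mpr hup
  have h2 : |d| - ε / 2 ≤ VC1 (Set.Icc a b) f L x₀ / L := by
    rw [le_div_iff₀ hL0]
    linarith
  rw [Real.dist_eq, abs_lt]
  constructor <;> linarith
end

section
/- For all functions f₁, f₂, f₃ : ℝⁿ → ℝ continuous on the compact domain Ω, the IVC distance satisfies the triangle inequality: Dist_IVC(f₁, f₃) ≤ Dist_IVC(f₁, f₂) + Dist_IVC(f₂, f₃). -/
/-- The value change (VC) of `f : ℝⁿ → ℝ` at `x` over the domain `Ω`,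
with window `∏ᵢ [xᵢ - L/2, xᵢ + L/2]`. -/
noncomputable def VC {n : ℕ} (Ω : Set (Fin n → ℝ)) (f : (Fin n → ℝ) → ℝ)
    (L : ℝ) (x : Fin n → ℝ) : ℝ :=
  sSup {v : ℝ | ∃ y₁ ∈ Ω ∩ Set.Icc (fun i => x i - L / 2) (fun i => x i + L / 2),
    ∃ y₂ ∈ Ω ∩ Set.Icc (fun i => x i - L / 2) (fun i => x i + L / 2), v = |f y₁ - f y₂|}

/-- The integral value change (IVC) of `f` at `x`:
the average of `VC_L(f, x)` over `L ∈ [Lmin, Lmax]`. -/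
noncomputable def IVC {n : ℕ} (Ω : Set (Fin n → ℝ)) (f : (Fin n → ℝ) → ℝ)
    (Lmin Lmax : ℝ) (x : Fin n → ℝ) : ℝ :=
  (1 / (Lmax - Lmin)) * ∫ L in Lmin..Lmax, VC Ω f L x

/-- The IVC distance between `f₁` and `f₂`: `∫_Ω IVC(f₁ − f₂, x) dx`. -/
noncomputable def DistIVC {n : ℕ} (Ω : Set (Fin n → ℝ)) (f₁ f₂ : (Fin n → ℝ) → ℝ)
    (Lmin Lmax : ℝ) : ℝ :=
  ∫ x in Ω, IVC Ω (fun y => f₁ y - f₂ y) Lmin Lmax x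

open MeasureTheory Set in
theorem VC_bdd {n : ℕ} (a b : Fin n → ℝ) (g : (Fin n → ℝ) → ℝ)
    (hg : ContinuousOn g (Icc a b)) :
    ∃ M : ℝ, 0 ≤ M ∧ ∀ y₁ ∈ Icc a b, ∀ y₂ ∈ Icc a b, |g y₁ - g y₂| ≤ M := by
  obtain ⟨C, hC⟩ := isCompact_Icc.exists_bound_of_continuousOn hg
  refine ⟨|C| + |C|, by positivity, fun y₁ h₁ y₂ h₂ => ?_⟩
  have h1 := hC y₁ h₁
  have h2 := hC y₂ h₂
  rw [Real.norm_eq_abs] at h1 h2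
  have := abs_sub (g y₁) (g y₂)
  have := le_abs_self C
  linarith

theorem VC_nonneg {n : ℕ} (Ω : Set (Fin n → ℝ)) (g : (Fin n → ℝ) → ℝ) (L : ℝ)
    (x : Fin n → ℝ) : 0 ≤ VC Ω g L x := by
  apply Real.sSup_nonneg
  rintro v ⟨y₁, -, y₂, -, rfl⟩
  exact abs_nonneg _

theorem le_VC_iff {n : ℕ} (a b : Fin n → ℝ) (g : (Fin n → ℝ) → ℝ)
    (hg : ContinuousOn g (Set.Icc a b)) (c : ℝ) (hc : 0 < c) (L : ℝ) (x : Fin n → ℝ) :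
    c ≤ VC (Set.Icc a b) g L x ↔
      ∃ y₁ ∈ Set.Icc a b ∩ Set.Icc (fun i => x i - L / 2) (fun i => x i + L / 2),
      ∃ y₂ ∈ Set.Icc a b ∩ Set.Icc (fun i => x i - L / 2) (fun i => x i + L / 2),
        c ≤ |g y₁ - g y₂| := by
  obtain ⟨M, hM0, hM⟩ := VC_bdd a b g hg
  constructor
  · intro h
    set W := Set.Icc a b ∩ Set.Icc (fun i => x i - L / 2) (fun i => x i + L / 2) with hW
    have hWc : IsCompact W := isCompact_Icc.inter isCompact_Icc
    have hgW : ContinuousOn g W := hg.mono Set.inter_subset_left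
    have hS : {v : ℝ | ∃ y₁ ∈ W, ∃ y₂ ∈ W, v = |g y₁ - g y₂|} =
        (fun p : (Fin n → ℝ) × (Fin n → ℝ) => |g p.1 - g p.2|) '' (W ×ˢ W) := by
      ext v
      constructor
      · rintro ⟨y₁, h₁, y₂, h₂, rfl⟩
        exact ⟨(y₁, y₂), ⟨h₁, h₂⟩, rfl⟩
      · rintro ⟨⟨y₁, y₂⟩, ⟨h₁, h₂⟩, rfl⟩
        exact ⟨y₁, h₁, y₂, h₂, rfl⟩
    have hcomp : IsCompact {v : ℝ | ∃ y₁ ∈ W, ∃ y₂ ∈ W, v = |g y₁ - g y₂|} := by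
      rw [hS]
      apply (hWc.prod hWc).image_of_continuousOn
      apply ContinuousOn.abs
      apply ContinuousOn.sub
      · exact hgW.comp continuousOn_fst (fun p hp => hp.1)
      · exact hgW.comp continuousOn_snd (fun p hp => hp.2)
    have hne : {v : ℝ | ∃ y₁ ∈ W, ∃ y₂ ∈ W, v = |g y₁ - g y₂|}.Nonempty := by
      by_contra hne
      rw [Set.not_nonempty_iff_eq_empty] at hne
      unfold VC at h
      rw [← hW, hne, Real.sSup_empty] at h
      linarith
    obtain ⟨y₁, h₁, y₂, h₂, he⟩ := hcomp.sSup_mem hne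
    refine ⟨y₁, h₁, y₂, h₂, ?_⟩
    rw [← he]
    exact h
  · rintro ⟨y₁, h₁, y₂, h₂, h⟩
    refine h.trans (le_csSup ⟨M, ?_⟩ ⟨y₁, h₁, y₂, h₂, rfl⟩)
    rintro v ⟨z₁, k₁, z₂, k₂, rfl⟩
    exact hM _ k₁.1 _ k₂.1

theorem VC_measurable {n : ℕ} (a b : Fin n → ℝ) (g : (Fin n → ℝ) → ℝ)
    (hg : ContinuousOn g (Set.Icc a b)) :
    Measurable (fun p : (Fin n → ℝ) × ℝ => VC (Set.Icc a b) g p.2 p.1) := by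
  apply measurable_of_Ici
  intro c
  rcases le_or_gt c 0 with hc | hc
  · convert MeasurableSet.univ
    ext p
    simp only [Set.mem_preimage, Set.mem_Ici, Set.mem_univ, iff_true]
    exact hc.trans (VC_nonneg _ _ _ _)
  · apply IsClosed.measurableSet
    have hgc : Continuous (fun y : Set.Icc a b => g y) := hg.domRestrict
    have : CompactSpace (Set.Icc a b) := isCompact_iff_compactSpace.mp isCompact_Icc
    let S : Set (((Fin n → ℝ) × ℝ) × (Set.Icc a b × Set.Icc a b)) :=
      {q | (((fun i => q.1.1 i - q.1.2 / 2) ≤ (q.2.1 : Fin n → ℝ) ∧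
          (q.2.1 : Fin n → ℝ) ≤ (fun i => q.1.1 i + q.1.2 / 2)) ∧
        ((fun i => q.1.1 i - q.1.2 / 2) ≤ (q.2.2 : Fin n → ℝ) ∧
          (q.2.2 : Fin n → ℝ) ≤ (fun i => q.1.1 i + q.1.2 / 2))) ∧
        c ≤ |g q.2.1 - g q.2.2|}
    have hS : IsClosed S := by
      simp only [S, Set.ofPred_and]
      refine IsClosed.inter (IsClosed.inter (IsClosed.inter ?_ ?_) (IsClosed.inter ?_ ?_)) ?_
      · exact isClosed_le (by fun_prop) (by fun_prop)
      · exact isClosed_le (by fun_prop) (by fun_prop)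
      · exact isClosed_le (by fun_prop) (by fun_prop)
      · exact isClosed_le (by fun_prop) (by fun_prop)
      · refine isClosed_le continuous_const (Continuous.abs (Continuous.sub ?_ ?_))
        · exact hgc.comp (continuous_fst.comp continuous_snd)
        · exact hgc.comp (continuous_snd.comp continuous_snd)
    convert isClosedMap_fst_of_compactSpace S hS
    ext p
    simp only [Set.mem_preimage, Set.mem_Ici]
    rw [le_VC_iff a b g hg c hc]
    constructor
    · rintro ⟨y₁, h₁, y₂, h₂, h⟩
      exact ⟨(p, (⟨y₁, h₁.1⟩, ⟨y₂, h₂.1⟩)), ⟨⟨h₁.2, h₂.2⟩, h⟩, rfl⟩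
    · rintro ⟨⟨p', ⟨y₁, y₂⟩⟩, ⟨⟨h₁, h₂⟩, h⟩, rfl⟩
      exact ⟨y₁, ⟨y₁.2, h₁⟩, y₂, ⟨y₂.2, h₂⟩, h⟩

theorem VC_norm_le {n : ℕ} (a b : Fin n → ℝ) (g : (Fin n → ℝ) → ℝ)
    (hg : ContinuousOn g (Set.Icc a b)) :
    ∃ M : ℝ, ∀ L x, ‖VC (Set.Icc a b) g L x‖ ≤ M := by
  obtain ⟨M, hM0, hM⟩ := VC_bdd a b g hg
  refine ⟨M, fun L x => ?_⟩
  rw [Real.norm_of_nonneg (VC_nonneg _ _ _ _)]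
  apply Real.sSup_le _ hM0
  rintro v ⟨y₁, h₁, y₂, h₂, rfl⟩
  exact hM _ h₁.1 _ h₂.1

theorem VC_intervalIntegrable {n : ℕ} (a b : Fin n → ℝ) (g : (Fin n → ℝ) → ℝ)
    (hg : ContinuousOn g (Set.Icc a b)) (l u : ℝ) (x : Fin n → ℝ) :
    IntervalIntegrable (fun L => VC (Set.Icc a b) g L x) MeasureTheory.volume l u := by
  obtain ⟨M, hM⟩ := VC_norm_le a b g hg
  have hx : Measurable (fun L : ℝ => (x, L)) := measurable_prodMk_left
  have hm' := (VC_measurable a b g hg).comp hx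
  have hm : Measurable (fun L => VC (Set.Icc a b) g L x) := hm'
  have hc : IntervalIntegrable (fun _ : ℝ => M) MeasureTheory.volume l u :=
    intervalIntegrable_const
  refine hc.mono_fun hm.aestronglyMeasurable (Filter.Eventually.of_forall fun L => ?_)
  exact (hM L x).trans (le_abs_self M)

theorem IVC_integrableOn {n : ℕ} (a b : Fin n → ℝ) (g : (Fin n → ℝ) → ℝ)
    (hg : ContinuousOn g (Set.Icc a b)) (l u : ℝ) (hlu : l ≤ u) :
    MeasureTheory.IntegrableOn (IVC (Set.Icc a b) g l u) (Set.Icc a b) := by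
  obtain ⟨M, hM⟩ := VC_norm_le a b g hg
  have hm : MeasureTheory.StronglyMeasurable
      (fun x => ∫ L in l..u, VC (Set.Icc a b) g L x) := by
    simp only [intervalIntegral.integral_of_le hlu]
    exact (VC_measurable a b g hg).stronglyMeasurable.integral_prod_right
  have : MeasureTheory.IsFiniteMeasure
      (MeasureTheory.volume.restrict (Set.Icc a b)) :=
    ⟨by rw [MeasureTheory.Measure.restrict_apply_univ]; exact isCompact_Icc.measure_lt_top⟩
  unfold MeasureTheory.IntegrableOn
  refine MeasureTheory.Integrable.const_mul (f := fun x => ∫ L in l..u, VC (Set.Icc a b) g L x)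
    (MeasureTheory.Integrable.of_bound hm.aestronglyMeasurable (M * |u - l|)
    (Filter.Eventually.of_forall fun x => ?_)) (1 / (u - l))
  exact intervalIntegral.norm_integral_le_of_norm_le_const fun L _ => hM L x

theorem VC_triangle {n : ℕ} (a b : Fin n → ℝ) (f₁ f₂ f₃ : (Fin n → ℝ) → ℝ)
    (h₁₂ : ContinuousOn (fun y => f₁ y - f₂ y) (Set.Icc a b))
    (h₂₃ : ContinuousOn (fun y => f₂ y - f₃ y) (Set.Icc a b)) (L : ℝ) (x : Fin n → ℝ) :
    VC (Set.Icc a b) (fun y => f₁ y - f₃ y) L x ≤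
      VC (Set.Icc a b) (fun y => f₁ y - f₂ y) L x +
        VC (Set.Icc a b) (fun y => f₂ y - f₃ y) L x := by
  obtain ⟨M, -, hM⟩ := VC_bdd a b _ h₁₂
  obtain ⟨N, -, hN⟩ := VC_bdd a b _ h₂₃
  apply Real.sSup_le _ (add_nonneg (VC_nonneg _ _ _ _) (VC_nonneg _ _ _ _))
  rintro v ⟨y₁, k₁, y₂, k₂, rfl⟩
  have e : f₁ y₁ - f₃ y₁ - (f₁ y₂ - f₃ y₂) =
      (f₁ y₁ - f₂ y₁ - (f₁ y₂ - f₂ y₂)) + (f₂ y₁ - f₃ y₁ - (f₂ y₂ - f₃ y₂)) := by ring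
  rw [e]
  refine (abs_add_le _ _).trans (add_le_add ?_ ?_)
  · refine le_csSup ⟨M, ?_⟩ ⟨y₁, k₁, y₂, k₂, rfl⟩
    rintro v ⟨z₁, j₁, z₂, j₂, rfl⟩
    exact hM _ j₁.1 _ j₂.1
  · refine le_csSup ⟨N, ?_⟩ ⟨y₁, k₁, y₂, k₂, rfl⟩
    rintro v ⟨z₁, j₁, z₂, j₂, rfl⟩
    exact hN _ j₁.1 _ j₂.1

/-- Triangle inequality for the IVC distance:
`Dist_IVC(f₁, f₃) ≤ Dist_IVC(f₁, f₂) + Dist_IVC(f₂, f₃)`. -/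
theorem stmt_8 {n : ℕ} (a b : Fin n → ℝ) (hab : ∀ i, a i < b i)
    (f₁ f₂ f₃ : (Fin n → ℝ) → ℝ)
    (hf₁ : ContinuousOn f₁ (Set.Icc a b)) (hf₂ : ContinuousOn f₂ (Set.Icc a b))
    (hf₃ : ContinuousOn f₃ (Set.Icc a b))
    (Lmin Lmax : ℝ) (hLmin : 0 ≤ Lmin) (hL : Lmin < Lmax) :
    DistIVC (Set.Icc a b) f₁ f₃ Lmin Lmax ≤
      DistIVC (Set.Icc a b) f₁ f₂ Lmin Lmax + DistIVC (Set.Icc a b) f₂ f₃ Lmin Lmax := by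
  have h₁₂ : ContinuousOn (fun y => f₁ y - f₂ y) (Set.Icc a b) := hf₁.sub hf₂
  have h₂₃ : ContinuousOn (fun y => f₂ y - f₃ y) (Set.Icc a b) := hf₂.sub hf₃
  have h₁₃ : ContinuousOn (fun y => f₁ y - f₃ y) (Set.Icc a b) := hf₁.sub hf₃
  unfold DistIVC
  rw [← MeasureTheory.integral_add (IVC_integrableOn a b _ h₁₂ _ _ hL.le)
    (IVC_integrableOn a b _ h₂₃ _ _ hL.le)]
  refine MeasureTheory.integral_mono (IVC_integrableOn a b _ h₁₃ _ _ hL.le)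
    ((IVC_integrableOn a b _ h₁₂ _ _ hL.le).add
    (IVC_integrableOn a b _ h₂₃ _ _ hL.le)) fun x => ?_
  show IVC _ _ _ _ x ≤ IVC _ _ _ _ x + IVC _ _ _ _ x
  unfold IVC
  rw [← mul_add, ← intervalIntegral.integral_add (VC_intervalIntegrable a b _ h₁₂ _ _ x)
    (VC_intervalIntegrable a b _ h₂₃ _ _ x)]
  refine mul_le_mul_of_nonneg_left ?_ (one_div_nonneg.mpr (sub_nonneg.mpr hL.le))
  exact intervalIntegral.integral_mono_on hL.le (VC_intervalIntegrable a b _ h₁₃ _ _ x)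
    ((VC_intervalIntegrable a b _ h₁₂ _ _ x).add (VC_intervalIntegrable a b _ h₂₃ _ _ x))
    fun L _ => VC_triangle a b f₁ f₂ f₃ h₁₂ h₂₃ L x
end

section
/- For all functions f₁, f₂ : ℝⁿ → ℝ continuous on the compact domain Ω, every κ ∈ ℝ, and all constants c₁, c₂ ∈ ℝ, the IVC distance satisfies Dist_IVC(κ·f₁ + c₁, κ·f₂ + c₂) = |κ| · Dist_IVC(f₁, f₂); in particular the IVC distance is invariant under adding constants to either argument. -/
/-- Scaling of the value change; shifts by constants cancel. -/
theorem VC_scale {n : ℕ} (Ω : Set (Fin n → ℝ)) (f₁ f₂ : (Fin n → ℝ) → ℝ)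
    (κ c₁ c₂ L : ℝ) (x : Fin n → ℝ) :
    VC Ω (fun y => (κ * f₁ y + c₁) - (κ * f₂ y + c₂)) L x =
      |κ| * VC Ω (fun y => f₁ y - f₂ y) L x := by
  unfold VC
  rw [← smul_eq_mul, ← Real.sSup_smul_of_nonneg (abs_nonneg κ)]
  congr 1
  have key : ∀ y₁ y₂ : Fin n → ℝ,
      |((κ * f₁ y₁ + c₁) - (κ * f₂ y₁ + c₂)) - ((κ * f₁ y₂ + c₁) - (κ * f₂ y₂ + c₂))| =
        |κ| * |(f₁ y₁ - f₂ y₁) - (f₁ y₂ - f₂ y₂)| := by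
    intro y₁ y₂
    rw [← abs_mul]
    congr 1
    ring
  ext v
  rw [Set.mem_smul_set]
  constructor
  · rintro ⟨y₁, h₁, y₂, h₂, rfl⟩
    exact ⟨_, ⟨y₁, h₁, y₂, h₂, rfl⟩, (key y₁ y₂).symm⟩
  · rintro ⟨_, ⟨y₁, h₁, y₂, h₂, rfl⟩, rfl⟩
    exact ⟨y₁, h₁, y₂, h₂, (key y₁ y₂).symm⟩

/-- Scaling and translation invariance of the IVC distance:
`Dist_IVC(κ·f₁ + c₁, κ·f₂ + c₂) = |κ| · Dist_IVC(f₁, f₂)`. -/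
theorem stmt_16 {n : ℕ} (a b : Fin n → ℝ) (hab : ∀ i, a i < b i)
    (f₁ f₂ : (Fin n → ℝ) → ℝ)
    (hf₁ : ContinuousOn f₁ (Set.Icc a b)) (hf₂ : ContinuousOn f₂ (Set.Icc a b))
    (Lmin Lmax : ℝ) (hLmin : 0 ≤ Lmin) (hL : Lmin < Lmax) (κ c₁ c₂ : ℝ) :
    DistIVC (Set.Icc a b) (fun y => κ * f₁ y + c₁) (fun y => κ * f₂ y + c₂) Lmin Lmax =
      |κ| * DistIVC (Set.Icc a b) f₁ f₂ Lmin Lmax := by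
  unfold DistIVC IVC
  simp only [VC_scale, intervalIntegral.integral_const_mul]
  rw [← MeasureTheory.integral_const_mul]
  congr 1
  ext x
  ring
end
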